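/- arXiv:2408.13901 — 2 statements merged into one kernel-verified Lean document; each statement's English description precedes it below -/
import Mathlib

section
/- Let f_r > 0 and f* ≥ f_r, and set RVI = (√(fΔ⁴+4fΔ²) − fΔ²)/2 with fΔ = f* − f_r. If f* < 1/f_r, then f_r² < 1 − RVI. -/
/-- If `f* < 1/f_r`, then `f_r² < 1 − RVI` where
`RVI = (√(fΔ⁴+4fΔ²) − fΔ²)/2`, `fΔ = f* − f_r`. -/
theorem stmt10 (f_r fstar : ℝ) (hf : 0 < f_r) (hle : f_r ≤ fstar)
    (hcond : fstar < 1 / f_r) :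
    f_r ^ 2 <
      1 - (Real.sqrt ((fstar - f_r) ^ 4 + 4 * (fstar - f_r) ^ 2) - (fstar - f_r) ^ 2) / 2 := by
  rw [lt_div_iff₀ hf] at hcond
  obtain ⟨d, rfl⟩ : ∃ d, fstar = f_r + d := ⟨fstar - f_r, by ring⟩
  have hd : 0 ≤ d := by linarith
  have e : f_r + d - f_r = d := by ring
  rw [e]
  have hfd : 0 ≤ f_r * d := mul_nonneg hf.le hd
  have hu : f_r * d < 1 - f_r ^ 2 := by nlinarith
  have hsq : (f_r * d) ^ 2 < (1 - f_r ^ 2) ^ 2 := pow_lt_pow_left₀ hu hfd two_ne_zero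
  have key : Real.sqrt (d ^ 4 + 4 * d ^ 2) < 2 * (1 - f_r ^ 2) + d ^ 2 := by
    rw [Real.sqrt_lt' (by nlinarith [sq_nonneg d])]
    nlinarith
  linarith
end

section
/- Let f_r ≥ 0, f* > 0 with f_r ≤ f* ≤ 1/f_r (taking 1/0 = ∞), fΔ = f* − f_r, and RVI = (√(fΔ⁴+4fΔ²) − fΔ²)/2. Then f_r·√(1−RVI) + RVI = f*·√(1−RVI), i.e., setting both partial R² equal to RVI makes the adjusted normalized t-statistic exactly equal to the critical threshold. -/
/-- Setting both partial R² equal to `RVI = (√(fΔ⁴+4fΔ²) − fΔ²)/2` makes the adjusted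
normalized t-statistic exactly equal to the critical threshold:
`f_r·√(1−RVI) + RVI = f*·√(1−RVI)`. -/
theorem stmt15 (f_r fstar : ℝ) (hf : 0 ≤ f_r) (hfs : 0 < fstar) (hle : f_r ≤ fstar)
    (hub : f_r * fstar ≤ 1) :
    f_r * Real.sqrt (1 -
        (Real.sqrt ((fstar - f_r) ^ 4 + 4 * (fstar - f_r) ^ 2) - (fstar - f_r) ^ 2) / 2) +
      (Real.sqrt ((fstar - f_r) ^ 4 + 4 * (fstar - f_r) ^ 2) - (fstar - f_r) ^ 2) / 2 =
    fstar * Real.sqrt (1 -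
        (Real.sqrt ((fstar - f_r) ^ 4 + 4 * (fstar - f_r) ^ 2) - (fstar - f_r) ^ 2) / 2) := by
  have hd : 0 ≤ fstar - f_r := sub_nonneg.mpr hle
  have key : ∀ d : ℝ, 0 ≤ d →
      d * Real.sqrt (1 - (Real.sqrt (d ^ 4 + 4 * d ^ 2) - d ^ 2) / 2) =
        (Real.sqrt (d ^ 4 + 4 * d ^ 2) - d ^ 2) / 2 := by
    intro d hd
    have hs : Real.sqrt (d ^ 4 + 4 * d ^ 2) ^ 2 = d ^ 4 + 4 * d ^ 2 :=
      Real.sq_sqrt (by positivity)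
    have hge : d ^ 2 ≤ Real.sqrt (d ^ 4 + 4 * d ^ 2) := by
      apply Real.le_sqrt_of_sq_le
      nlinarith [sq_nonneg d]
    generalize Real.sqrt (d ^ 4 + 4 * d ^ 2) = s at hs hge
    have hR : 0 ≤ (s - d ^ 2) / 2 := by linarith
    have h1 : d ^ 2 * (1 - (s - d ^ 2) / 2) = ((s - d ^ 2) / 2) ^ 2 := by nlinarith
    calc d * Real.sqrt (1 - (s - d ^ 2) / 2)
        = Real.sqrt (d ^ 2 * (1 - (s - d ^ 2) / 2)) := by
          rw [Real.sqrt_mul (sq_nonneg d), Real.sqrt_sq hd]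
      _ = (s - d ^ 2) / 2 := by rw [h1, Real.sqrt_sq hR]
  have h := key (fstar - f_r) hd
  linarith
end
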